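/- Let τ : A → A* be a primitive substitution on a finite alphabet A that is prolongable on a letter a, and let x = τ^ω(a) be its fixed point. Then every length-2 factor of x is C-balanced in x for some constant C (depending on the factor) if and only if x is uniformly factor-balanced. -/

import Mathlib

open scoped Classical

section Core

variable {A : Type*} {B : Type*}

/-- `w` occurs at position `i` of the infinite word `x`. -/
def OccursAt (x : ℕ → A) (w : List A) (i : ℕ) : Prop :=
  w = (List.range w.length).map fun j => x (i + j)

/-- `w` is a factor of the infinite word `x`. -/
def IsFactor (x : ℕ → A) (w : List A) : Prop := ∃ i, OccursAt x w i

/-- The number of (possibly overlapping) occurrences of `w` in the finite word `u`,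
i.e. `|u|_w`. -/
noncomputable def countOccs (u w : List A) : ℕ :=
  ((Finset.range (u.length + 1)).filter fun i => w <+: u.drop i).card

/-- The finite word `w` is `C`-balanced in the infinite word `x`. -/
def BalancedIn (C : ℝ) (w : List A) (x : ℕ → A) : Prop :=
  ∀ u v : List A, IsFactor x u → IsFactor x v → u.length = v.length →
    |(countOccs u w : ℝ) - (countOccs v w : ℝ)| ≤ C

/-- Every finite word is `C_w`-balanced in `x` for some constant `C_w > 0`. -/
def FactorBalanced (x : ℕ → A) : Prop :=
  ∀ w : List A, ∃ C : ℝ, 0 < C ∧ BalancedIn C w x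

/-- There is a single constant `C > 0` such that every finite word is `C`-balanced in `x`. -/
def UniformlyFactorBalanced (x : ℕ → A) : Prop :=
  ∃ C : ℝ, 0 < C ∧ ∀ w : List A, BalancedIn C w x

/-- Every letter is `C`-balanced in `x`. -/
def LetterBalanced (C : ℝ) (x : ℕ → A) : Prop :=
  ∀ a : A, BalancedIn C [a] x

/-- `x` is `P`-power-free: no factor of `x` is a `P`-th power of a nonempty word. -/
def PowerFree (P : ℕ) (x : ℕ → A) : Prop :=
  ∀ v : List A, v ≠ [] → ¬ IsFactor x (List.flatten (List.replicate P v))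

/-- The length-`n` prefix of the infinite word `x`. -/
def wordPrefix (x : ℕ → A) (n : ℕ) : List A := (List.range n).map x

/-- The extension of a substitution to finite words. -/
def substWord (τ : A → List B) (w : List A) : List B := (w.map τ).flatten

/-- The word `w` has (prefix) frequency `μ` in `x`. -/
def HasFreq (x : ℕ → A) (w : List A) (μ : ℝ) : Prop :=
  Filter.Tendsto (fun n => (countOccs (wordPrefix x n) w : ℝ) / n)
    Filter.atTop (nhds μ)

/-- `τ` is `k`-decisive in `x` with witness map `r` (each `r a` of length `k ≥ 1`,
and `τ b` starts with `r a` whenever `ab` is a factor of `x`). -/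
def DecisiveWith (τ : A → List B) (x : ℕ → A) (r : A → List B) (k : ℕ) : Prop :=
  1 ≤ k ∧ (∀ a, (r a).length = k) ∧
    ∀ a b : A, IsFactor x [a, b] → r a <+: τ b

/-- `τ` is `k`-decisive in `x`. -/
def Decisive (τ : A → List B) (x : ℕ → A) (k : ℕ) : Prop :=
  ∃ r : A → List B, DecisiveWith τ x r k

/-- The image of the infinite word `x` under the substitution `τ`: when the images of
prefixes of `x` have unbounded length, `substInf τ x` is the infinite word `τ(x)`. -/
noncomputable def substInf [Nonempty B] (τ : A → List B) (x : ℕ → A) (j : ℕ) : B :=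
  if h : ∃ n, j < (substWord τ (wordPrefix x n)).length
  then (substWord τ (wordPrefix x (Nat.find h))).get ⟨j, Nat.find_spec h⟩
  else Classical.arbitrary B

/-- Iterates of a substitution: `substIter τ n a = τ^n(a)` as a finite word. -/
def substIter (τ : A → List A) : ℕ → A → List A
  | 0, a => [a]
  | n+1, a => substWord (substIter τ n) (τ a)

/-- `τ` is prolongable on the letter `a`. -/
def Prolongable (τ : A → List A) (a : A) : Prop :=
  (τ a).head? = some a ∧ (∀ b, τ b ≠ []) ∧
    Filter.Tendsto (fun n => (substIter τ n a).length) Filter.atTop Filter.atTop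

/-- The fixed point `τ^ω(a)` of a substitution prolongable on `a`:
the limit of the prefix chain `τ^n(a)`. -/
noncomputable def fixedPoint (τ : A → List A) (a : A) (j : ℕ) : A :=
  if h : ∃ n, j < (substIter τ n a).length
  then (substIter τ (Nat.find h) a).get ⟨j, Nat.find_spec h⟩
  else a

/-- The factor complexity of `x`: the number of distinct length-`n` factors. -/
noncomputable def complexity (x : ℕ → A) (n : ℕ) : ℕ :=
  Set.ncard {w : List A | w.length = n ∧ IsFactor x w}

/-- Every factor of `x` occurs infinitely often in `x`. -/
def Recurrent (x : ℕ → A) : Prop :=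
  ∀ w : List A, IsFactor x w → ∀ N : ℕ, ∃ i, N ≤ i ∧ OccursAt x w i

/-- For every factor `w` of `x` there is `k` such that `w` occurs in
every length-`k` factor of `x`. -/
def UniformlyRecurrent (x : ℕ → A) : Prop :=
  ∀ w : List A, IsFactor x w → ∃ k : ℕ, ∀ v : List A, IsFactor x v →
    v.length = k → 1 ≤ countOccs v w

end Core

section Words

variable {A : Type*}

lemma occursAt_iff (x : ℕ → A) (w : List A) (i : ℕ) :
    OccursAt x w i ↔ ∀ t < w.length, w[t]? = some (x (i + t)) := by
  unfold OccursAt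
  constructor
  · intro h t ht
    rw [h]
    simp [ht]
  · intro h
    apply List.ext_getElem?
    intro t
    by_cases ht : t < w.length
    · rw [h t ht]; simp [ht]
    · simp [not_lt.1 ht]

lemma occursAt_congr {x : ℕ → A} {w : List A} {i j : ℕ}
    (h : ∀ t < w.length, x (i + t) = x (j + t)) : OccursAt x w i ↔ OccursAt x w j := by
  rw [occursAt_iff, occursAt_iff]
  exact forall₂_congr fun t ht => by rw [h t ht]

lemma OccursAt.apply_eq {x : ℕ → A} {w : List A} {i j : ℕ} (hi : OccursAt x w i)
    (hj : OccursAt x w j) {t : ℕ} (ht : t < w.length) : x (i + t) = x (j + t) := by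
  rw [occursAt_iff] at hi hj
  exact Option.some_injective _ ((hi t ht).symm.trans (hj t ht))

lemma occursAt_pair (x : ℕ → A) (b c : A) (i : ℕ) :
    OccursAt x [b, c] i ↔ (x i, x (i + 1)) = (b, c) := by
  simp [OccursAt, List.range_succ, eq_comm]

lemma isPrefix_drop_iff {x : ℕ → A} {u w : List A} {i t : ℕ} (hu : OccursAt x u i)
    (ht : t ≤ u.length) :
    w <+: u.drop t ↔ t + w.length ≤ u.length ∧ OccursAt x w (i + t) := by
  rw [occursAt_iff] at hu ⊢
  constructor
  · intro h
    have hl := h.length_le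
    rw [List.length_drop] at hl
    refine ⟨by omega, fun s hs => ?_⟩
    have := List.prefix_iff_getElem?.1 h s hs
    rw [List.getElem?_drop, hu _ (by omega)] at this
    rw [List.getElem?_eq_getElem hs, ← this, add_assoc]
  · rintro ⟨hl, h⟩
    rw [List.prefix_iff_getElem?]
    intro s hs
    rw [List.getElem?_drop, hu _ (by omega), ← add_assoc, ← h s hs, List.getElem?_eq_getElem hs]

/-- Occurrences of `w` in a factor `u` of `x` are occurrences of `w` in a window of `x`. -/
lemma countOccs_eq_count {x : ℕ → A} {u w : List A} {i : ℕ} (hu : OccursAt x u i) :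
    countOccs u w = Nat.count (fun t => OccursAt x w (i + t)) (u.length + 1 - w.length) := by
  rw [Nat.count_eq_card_filter_range, countOccs]
  congr 1
  ext t
  simp only [Finset.mem_filter, Finset.mem_range]
  constructor
  · rintro ⟨h1, h2⟩
    rw [isPrefix_drop_iff hu (by omega)] at h2
    exact ⟨by omega, h2.2⟩
  · rintro ⟨h1, h2⟩
    refine ⟨by omega, ?_⟩
    rw [isPrefix_drop_iff hu (by omega)]
    exact ⟨by omega, h2⟩

lemma occursAt_window (x : ℕ → A) (i n : ℕ) :
    OccursAt x ((List.range n).map fun j => x (i + j)) i := by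
  simp [OccursAt]

/-- Balancedness of `w` in terms of the number of occurrences in windows of `x`. -/
lemma balancedIn_iff_count (C : ℝ) (hC : 0 ≤ C) {w : List A} (x : ℕ → A) :
    BalancedIn C w x ↔ ∀ i j n : ℕ,
      |(Nat.count (fun t => OccursAt x w (i + t)) n : ℝ) -
        Nat.count (fun t => OccursAt x w (j + t)) n| ≤ C := by
  constructor
  · intro h i j n
    rcases Nat.eq_zero_or_pos w.length with hw | hw
    · simpa [List.length_eq_zero_iff.1 hw, OccursAt, Nat.count_true] using hC
    rcases Nat.eq_zero_or_pos n with rfl | hn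
    · simpa using hC
    have := h _ _ ⟨i, occursAt_window x i (n + w.length - 1)⟩
      ⟨j, occursAt_window x j (n + w.length - 1)⟩ (by simp)
    rw [countOccs_eq_count (occursAt_window x i _),
      countOccs_eq_count (occursAt_window x j _)] at this
    simp only [List.length_map, List.length_range] at this
    rwa [show n + w.length - 1 + 1 - w.length = n by omega] at this
  · rintro h u v ⟨i, hi⟩ ⟨j, hj⟩ huv
    rw [countOccs_eq_count hi, countOccs_eq_count hj, huv]
    exact h i j _

/-- In a purely periodic word, all words are balanced with twice the period as constant. -/
lemma balancedIn_of_periodic {x : ℕ → A} {p : ℕ} (hp : 0 < p) (hx : ∀ i, x (i + p) = x i)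
    (w : List A) : BalancedIn (2 * p) w x := by
  have hocc : Function.Periodic (OccursAt x w) p := fun i => by
    refine propext (occursAt_congr fun t _ => ?_)
    rw [add_right_comm, hx]
  have key : ∀ i n : ℕ, ∃ r < p, Nat.count (fun t => OccursAt x w (i + t)) n +
      Nat.count (OccursAt x w) r = Nat.count (OccursAt x w) n +
        Nat.count (fun t => OccursAt x w (n + t)) r := by
    intro i n
    refine ⟨i % p, Nat.mod_lt _ hp, ?_⟩
    have : (fun t => OccursAt x w (i + t)) = fun t => OccursAt x w (i % p + t) := by
      funext t
      conv_lhs => rw [← Nat.mod_add_div i p, add_right_comm, mul_comm p]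
      exact hocc.nat_mul _ _
    simp only [this]
    rw [add_comm, ← Nat.count_add, ← Nat.count_add, add_comm]
  have bound : ∀ i n : ℕ, Nat.count (fun t => OccursAt x w (i + t)) n ≤
      Nat.count (OccursAt x w) n + p ∧ Nat.count (OccursAt x w) n ≤
      Nat.count (fun t => OccursAt x w (i + t)) n + p := by
    intro i n
    obtain ⟨r, hr, h⟩ := key i n
    have h1 := Nat.count_le (p := OccursAt x w) (n := r)
    have h2 := Nat.count_le (p := fun t => OccursAt x w (n + t)) (n := r)
    omega
  rw [balancedIn_iff_count _ (by positivity)]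
  intro i j n
  obtain ⟨h1, h2⟩ := bound i n
  obtain ⟨h3, h4⟩ := bound j n
  rw [abs_le]
  have h5 : Nat.count (fun t => OccursAt x w (j + t)) n ≤
      Nat.count (fun t => OccursAt x w (i + t)) n + 2 * p := by omega
  have h6 : Nat.count (fun t => OccursAt x w (i + t)) n ≤
      Nat.count (fun t => OccursAt x w (j + t)) n + 2 * p := by omega
  rify at h5 h6
  constructor <;> linarith

end Words

section Substitution

variable {A : Type*}

lemma substWord_append {B : Type*} (σ : A → List B) (u v : List A) :
    substWord σ (u ++ v) = substWord σ u ++ substWord σ v := by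
  simp [substWord]

lemma substWord_singleton {B : Type*} (σ : A → List B) (b : A) : substWord σ [b] = σ b := by
  simp [substWord]

lemma substWord_substWord {B D : Type*} (σ : B → List D) (ρ : A → List B) (w : List A) :
    substWord σ (substWord ρ w) = substWord (fun b => substWord σ (ρ b)) w := by
  induction w with
  | nil => rfl
  | cons b w ih =>
    rw [← List.singleton_append, substWord_append, substWord_append, substWord_append, ih,
      substWord_singleton, substWord_singleton]

lemma length_substWord {B : Type*} (σ : A → List B) (w : List A) :
    (substWord σ w).length = (w.map fun b => (σ b).length).sum := by
  simp [substWord, List.length_flatten, Function.comp_def]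

lemma length_substWord_le {B : Type*} (σ : A → List B) {w : List A} {K : ℕ}
    (h : ∀ b ∈ w, (σ b).length ≤ K) : (substWord σ w).length ≤ w.length * K := by
  rw [length_substWord]
  simpa using List.sum_le_card_nsmul (w.map fun b => (σ b).length) K (by simpa using h)

lemma length_le_length_substWord {B : Type*} (σ : A → List B) {w : List A} {b : A} (h : b ∈ w) :
    (σ b).length ≤ (substWord σ w).length := by
  rw [length_substWord]
  exact List.single_le_sum (by simp) _ (List.mem_map_of_mem h)

lemma wordPrefix_succ {B : Type*} (x : ℕ → B) (j : ℕ) :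
    wordPrefix x (j + 1) = wordPrefix x j ++ [x j] := by
  simp [wordPrefix, List.range_succ]

lemma substIter_add (τ : A → List A) (n k : ℕ) (b : A) :
    substIter τ (n + k) b = substWord (substIter τ n) (substIter τ k b) := by
  induction k generalizing b with
  | zero => simp [substIter, substWord_singleton]
  | succ k ih =>
    rw [← add_assoc, substIter, substIter, substWord_substWord]
    congr 1
    funext b
    exact ih b

lemma length_substIter_pos {τ : A → List A} (hτ : ∀ b, τ b ≠ []) (n : ℕ) (b : A) :
    0 < (substIter τ n b).length := by
  induction n generalizing b with
  | zero => simp [substIter]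
  | succ n ih =>
    obtain ⟨c, hc⟩ := List.exists_mem_of_ne_nil _ (hτ b)
    exact (ih c).trans_le (length_le_length_substWord _ hc)

lemma substIter_one (τ : A → List A) (b : A) : substIter τ 1 b = τ b := by
  simp [substIter, substWord, ← List.flatMap_def]

/-- The position in `x` at which the `n`-th iterated image of the letter `x j` begins. -/
def blockPos (τ : A → List A) (x : ℕ → A) (n j : ℕ) : ℕ :=
  (substWord (substIter τ n) (wordPrefix x j)).length

lemma blockPos_zero (τ : A → List A) (x : ℕ → A) (n : ℕ) : blockPos τ x n 0 = 0 := by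
  simp [blockPos, wordPrefix, substWord]

lemma blockPos_succ (τ : A → List A) (x : ℕ → A) (n j : ℕ) :
    blockPos τ x n (j + 1) = blockPos τ x n j + (substIter τ n (x j)).length := by
  simp [blockPos, wordPrefix_succ, substWord_append, substWord_singleton]

lemma blockPos_lt_succ {τ : A → List A} (hτ : ∀ b, τ b ≠ []) (x : ℕ → A) (n j : ℕ) :
    blockPos τ x n j < blockPos τ x n (j + 1) := by
  have := length_substIter_pos hτ n (x j)
  rw [blockPos_succ]
  omega

lemma blockPos_mono (τ : A → List A) (x : ℕ → A) (n : ℕ) : Monotone (blockPos τ x n) :=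
  monotone_nat_of_le_succ fun j => by rw [blockPos_succ]; omega

section FixedPoint

variable {τ : A → List A} {a : A}

lemma isPrefix_substIter_succ (hprol : Prolongable τ a) (k : ℕ) :
    substIter τ k a <+: substIter τ (k + 1) a := by
  have h := hprol.1
  rw [substIter]
  cases hτ : τ a with
  | nil => simp [hτ] at h
  | cons b t =>
    obtain rfl : b = a := by simpa [hτ] using h
    exact ⟨substWord (substIter τ k) t, by
      rw [← List.singleton_append, substWord_append, substWord_singleton]⟩

lemma isPrefix_substIter (hprol : Prolongable τ a) {k l : ℕ} (h : k ≤ l) :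
    substIter τ k a <+: substIter τ l a := by
  induction l, h using Nat.le_induction with
  | base => exact List.prefix_rfl
  | succ l _ ih => exact ih.trans (isPrefix_substIter_succ hprol l)

lemma substIter_getElem_fixedPoint (hprol : Prolongable τ a)
    {k j : ℕ} (h : j < (substIter τ k a).length) :
    (substIter τ k a)[j]? = some (fixedPoint τ a j) := by
  have hex : ∃ n, j < (substIter τ n a).length := ⟨k, h⟩
  rw [fixedPoint, dif_pos hex, List.get_eq_getElem, ← List.getElem?_eq_getElem]
  exact ((List.prefix_iff_getElem?.1 (isPrefix_substIter hprol (Nat.find_min' hex h)) j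
    (Nat.find_spec hex)).trans (List.getElem?_eq_getElem _).symm)

lemma wordPrefix_fixedPoint_eq_take (hprol : Prolongable τ a)
    {k j : ℕ} (h : j ≤ (substIter τ k a).length) :
    wordPrefix (fixedPoint τ a) j = (substIter τ k a).take j := by
  apply List.ext_getElem?
  intro i
  by_cases hi : i < j
  · rw [List.getElem?_take_of_lt hi, substIter_getElem_fixedPoint hprol (by omega)]
    simp [wordPrefix, hi]
  · simp [wordPrefix, hi]

/-- The fixed point is the concatenation of the iterated images of its letters. -/
lemma substWord_wordPrefix_fixedPoint (hprol : Prolongable τ a) (n j : ℕ) :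
    substWord (substIter τ n) (wordPrefix (fixedPoint τ a) j) =
      wordPrefix (fixedPoint τ a) (blockPos τ (fixedPoint τ a) n j) := by
  obtain ⟨k, hk⟩ := (hprol.2.2.eventually_ge_atTop j).exists
  have hpre : substWord (substIter τ n) (wordPrefix (fixedPoint τ a) j) <+:
      substIter τ (n + k) a := by
    rw [wordPrefix_fixedPoint_eq_take hprol hk, substIter_add]
    refine ⟨substWord (substIter τ n) ((substIter τ k a).drop j), ?_⟩
    rw [← substWord_append, List.take_append_drop]
  rw [blockPos, wordPrefix_fixedPoint_eq_take hprol (k := n + k) hpre.length_le]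
  exact List.prefix_iff_eq_take.1 hpre

lemma blockPos_blockPos (hprol : Prolongable τ a) (n k j : ℕ) :
    blockPos τ (fixedPoint τ a) n (blockPos τ (fixedPoint τ a) k j) =
      blockPos τ (fixedPoint τ a) (n + k) j := by
  conv_lhs => rw [blockPos, ← substWord_wordPrefix_fixedPoint hprol, substWord_substWord]
  simp only [blockPos, ← substIter_add]

lemma substIter_getElem_eq_fixedPoint (hprol : Prolongable τ a) (n j : ℕ) {t : ℕ}
    (ht : t < (substIter τ n (fixedPoint τ a j)).length) :
    (substIter τ n (fixedPoint τ a j))[t]? =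
      some (fixedPoint τ a (blockPos τ (fixedPoint τ a) n j + t)) := by
  have h := congrArg (fun l => l[blockPos τ (fixedPoint τ a) n j + t]?)
    (substWord_wordPrefix_fixedPoint hprol n (j + 1))
  beta_reduce at h
  rw [wordPrefix_succ, substWord_append, substWord_singleton, List.getElem?_append_right
    (by rw [blockPos]; omega), blockPos_succ] at h
  simpa [blockPos, wordPrefix, ht] using h

/-- Equal letters have equal iterated images inside the fixed point. -/
lemma fixedPoint_block_congr (hprol : Prolongable τ a)
    (n : ℕ) {i j t : ℕ} (hij : fixedPoint τ a i = fixedPoint τ a j)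
    (ht : t < (substIter τ n (fixedPoint τ a i)).length) :
    fixedPoint τ a (blockPos τ (fixedPoint τ a) n i + t) =
      fixedPoint τ a (blockPos τ (fixedPoint τ a) n j + t) := by
  have h1 := substIter_getElem_eq_fixedPoint hprol n i ht
  rw [hij] at ht h1
  exact Option.some_injective _ (h1.symm.trans (substIter_getElem_eq_fixedPoint hprol n j ht))

/-- Equal pairs of letters have equal iterated images inside the fixed point. -/
lemma fixedPoint_block_pair_congr (hprol : Prolongable τ a) (n : ℕ) {i j t : ℕ}
    (hij : fixedPoint τ a i = fixedPoint τ a j)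
    (hij' : fixedPoint τ a (i + 1) = fixedPoint τ a (j + 1))
    (ht : t < (substIter τ n (fixedPoint τ a i)).length +
      (substIter τ n (fixedPoint τ a (i + 1))).length) :
    fixedPoint τ a (blockPos τ (fixedPoint τ a) n i + t) =
      fixedPoint τ a (blockPos τ (fixedPoint τ a) n j + t) := by
  by_cases h : t < (substIter τ n (fixedPoint τ a i)).length
  · exact fixedPoint_block_congr hprol n hij h
  · obtain ⟨s, rfl⟩ := Nat.exists_eq_add_of_le (not_lt.1 h)
    rw [← add_assoc, ← add_assoc, ← blockPos_succ]
    conv_rhs => rw [hij, ← blockPos_succ]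
    exact fixedPoint_block_congr hprol n hij' (by omega)

end FixedPoint

end Substitution

/-- Every position lies in one of the blocks cut out by `pos`. -/
lemma exists_block {pos : ℕ → ℕ} (h0 : pos 0 = 0) (hpos : ∀ j, pos j < pos (j + 1)) (q : ℕ) :
    ∃ j, pos j ≤ q ∧ q < pos (j + 1) := by
  have hex : ∃ j, q < pos j :=
    ⟨q + 1, Nat.lt_of_succ_le ((strictMono_nat_of_lt_succ hpos).le_apply)⟩
  obtain ⟨j, hj⟩ : ∃ j, Nat.find hex = j + 1 :=
    Nat.exists_eq_succ_of_ne_zero fun h => by have := Nat.find_spec hex; rw [h, h0] at this; omega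
  refine ⟨j, not_lt.1 (Nat.find_min hex (by omega)), ?_⟩
  rw [← hj]
  exact Nat.find_spec hex

section Primitive

variable {A : Type*} [Fintype A] {τ : A → List A} {a : A}

/-- The lengths of the `n`-th iterated images of the letters are comparable. -/
lemma exists_length_substIter_le_mul (hprim : ∃ k, 1 ≤ k ∧ ∀ b b' : A, b ∈ substIter τ k b') :
    ∃ R, ∀ n b c, (substIter τ n b).length ≤ R * (substIter τ n c).length := by
  obtain ⟨k, -, hk⟩ := hprim
  refine ⟨∑ b, (substIter τ k b).length, fun n b c => ?_⟩
  calc (substIter τ n b).length ≤ (substIter τ (n + k) c).length := by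
        rw [substIter_add]; exact length_le_length_substWord _ (hk b c)
    _ = (substWord (substIter τ k) (substIter τ n c)).length := by
        rw [← substIter_add, add_comm]
    _ ≤ _ := by
        rw [mul_comm]
        exact length_substWord_le _ fun b _ =>
          Finset.single_le_sum (f := fun b => (substIter τ k b).length) (fun _ _ => Nat.zero_le _)
            (Finset.mem_univ b)

/-- Every length scale is realised by some iterate, up to a bounded factor. -/
lemma exists_scale (hprol : Prolongable τ a)
    (hprim : ∃ k, 1 ≤ k ∧ ∀ b b' : A, b ∈ substIter τ k b') :
    ∃ Q, ∀ m, 1 ≤ m → ∃ n, ∀ b,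
      m ≤ (substIter τ n b).length ∧ (substIter τ n b).length ≤ Q * m := by
  obtain ⟨R, hR⟩ := exists_length_substIter_le_mul hprim
  refine ⟨1 + (∑ b, (τ b).length) * R, fun m hm => ?_⟩
  have hex : ∃ n, ∀ b, m ≤ (substIter τ n b).length := by
    obtain ⟨n, hn⟩ := (hprol.2.2.eventually_ge_atTop (R * m)).exists
    refine ⟨n, fun b => ?_⟩
    have hR0 : 0 < R := by
      have := hR 0 a a
      simp only [substIter, List.length_singleton] at this
      omega
    exact Nat.le_of_mul_le_mul_left (hn.trans (hR n a b)) hR0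
  refine ⟨Nat.find hex, fun b => ⟨Nat.find_spec hex b, ?_⟩⟩
  rcases h : Nat.find hex with _ | n
  · simp only [substIter, List.length_singleton]; rw [add_mul]; omega
  · obtain ⟨c, hc⟩ := not_forall.1 (Nat.find_min hex (m := n) (by omega))
    have h1 : (substIter τ (n + 1) b).length ≤
        (substIter τ n b).length * ∑ b, (τ b).length := by
      rw [add_comm, substIter_add]
      exact length_substWord_le _ fun b _ => by
        rw [substIter_one]
        exact Finset.single_le_sum (f := fun b => (τ b).length) (fun _ _ => Nat.zero_le _)
          (Finset.mem_univ b)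
    calc _ ≤ _ := h1
      _ ≤ (R * m) * ∑ b, (τ b).length := by
        gcongr
        exact (hR n b c).trans (by gcongr; omega)
      _ ≤ _ := by rw [add_mul]; apply le_add_left; apply le_of_eq; ring

/-- Some iterate of every letter of the fixed point contains all length-2 factors. -/
lemma exists_pair_in_block (hprol : Prolongable τ a)
    (hprim : ∃ k, 1 ≤ k ∧ ∀ b b' : A, b ∈ substIter τ k b') :
    ∃ N, ∀ i j, ∃ l,
    blockPos τ (fixedPoint τ a) N j ≤ l ∧ l + 2 ≤ blockPos τ (fixedPoint τ a) N (j + 1) ∧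
      fixedPoint τ a l = fixedPoint τ a i ∧ fixedPoint τ a (l + 1) = fixedPoint τ a (i + 1) := by
  have hcongr := @fixedPoint_block_congr A τ a hprol
  have hpos := blockPos_blockPos hprol
  have hget := substIter_getElem_eq_fixedPoint hprol
  have hget0 := @substIter_getElem_fixedPoint A τ a hprol 0 0 (by simp [substIter])
  set x := fixedPoint τ a
  have hfin : ∃ J, ∀ i, ∃ l ≤ J, x l = x i ∧ x (l + 1) = x (i + 1) := by
    let y : ℕ → A × A := fun i => (x i, x (i + 1))
    choose f hf using fun p : Set.range y => p.2
    obtain ⟨J, hJ⟩ := (Set.finite_range f).bddAbove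
    refine ⟨J, fun i => ⟨f ⟨y i, i, rfl⟩, hJ ⟨_, rfl⟩, ?_⟩⟩
    exact Prod.ext_iff.1 (hf ⟨y i, i, rfl⟩)
  obtain ⟨J, hJ⟩ := hfin
  obtain ⟨n, hn⟩ := (hprol.2.2.eventually_ge_atTop (J + 2)).exists
  obtain ⟨k, -, hk⟩ := hprim
  refine ⟨n + k, fun i j => ?_⟩
  obtain ⟨l, hl, h1, h2⟩ := hJ i
  obtain ⟨s, hs, hsa⟩ := List.getElem_of_mem (hk a (x j))
  have hxs : x (blockPos τ x k j + s) = a := by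
    have := hget k j hs
    rw [List.getElem?_eq_getElem hs, hsa] at this
    exact (Option.some_injective _ this).symm
  have h0 : x 0 = a := by
    simpa [substIter] using hget0.symm
  have hcopy : ∀ t < (substIter τ n a).length,
      x (blockPos τ x n (blockPos τ x k j + s) + t) = x t := by
    intro t ht
    rw [hcongr n (j := 0) (hxs.trans h0.symm) (by rwa [hxs]),
      blockPos_zero, zero_add]
  refine ⟨blockPos τ x n (blockPos τ x k j + s) + l, ?_, ?_, ?_, ?_⟩
  · rw [← hpos]
    exact le_add_right (blockPos_mono _ _ _ (by omega))
  · rw [← hpos]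
    calc _ ≤ blockPos τ x n (blockPos τ x k j + s + 1) := by
          rw [blockPos_succ, hxs]; omega
      _ ≤ _ := blockPos_mono _ _ _ (by rw [blockPos_succ]; omega)
  · rw [hcopy _ (by omega), h1]
  · rw [add_assoc, hcopy _ (by omega), h2]

/-- Unless the fixed point is periodic, a word cannot occur at two positions that are close
relative to its length. -/
lemma exists_gap_or_periodic (hprol : Prolongable τ a)
    (hprim : ∃ k, 1 ≤ k ∧ ∀ b b' : A, b ∈ substIter τ k b') :
    (∃ p, 0 < p ∧ ∀ i, fixedPoint τ a (i + p) = fixedPoint τ a i) ∨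
    ∃ T, ∀ (w : List A) (i p : ℕ), 0 < p → OccursAt (fixedPoint τ a) w i →
      OccursAt (fixedPoint τ a) w (i + p) → w.length < T * p := by
  obtain ⟨Q, hQ⟩ := exists_scale hprol hprim
  obtain ⟨N, hN⟩ := exists_pair_in_block hprol hprim
  have hcongr := @fixedPoint_block_pair_congr A τ a hprol
  have hcomp := blockPos_blockPos hprol
  set x := fixedPoint τ a
  refine or_iff_not_imp_left.2 fun hper => ⟨2 * ((∑ b, (substIter τ N b).length) * Q), ?_⟩
  intro w i p hp hi hip
  by_contra! hlen
  refine hper ⟨p, hp, fun q => ?_⟩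
  obtain ⟨s, hs⟩ := hQ p hp
  have hbig : ∀ b, (substIter τ (s + N) b).length ≤
      ((∑ b, (substIter τ N b).length) * Q) * p := by
    intro b
    rw [substIter_add, mul_assoc]
    refine (length_substWord_le _ fun c _ => (hs c).2).trans ?_
    gcongr
    exact Finset.single_le_sum (f := fun b => (substIter τ N b).length)
      (fun _ _ => Nat.zero_le _) (Finset.mem_univ b)
  obtain ⟨j, hj1, hj2⟩ := exists_block (blockPos_zero τ x (s + N))
    (blockPos_lt_succ hprol.2.1 x (s + N)) i
  obtain ⟨j', hq1, hq2⟩ := exists_block (blockPos_zero τ x s) (blockPos_lt_succ hprol.2.1 x s) q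
  obtain ⟨l, hl1, hl2, hl3, hl4⟩ := hN j' (j + 1)
  have hl1' := blockPos_mono τ x s hl1
  have hl2' := blockPos_mono τ x s hl2
  rw [hcomp] at hl1' hl2'
  have e1 := blockPos_succ τ x (s + N) j
  have e2 := blockPos_succ τ x (s + N) (j + 1)
  have e3 := blockPos_succ τ x s l
  have e4 : blockPos τ x s (l + 2) = _ := blockPos_succ τ x s (l + 1)
  have e5 := blockPos_succ τ x s j'
  have b1 := hbig (x j)
  have b2 := hbig (x (j + 1))
  have b3 := (hs (x (j' + 1))).1
  rw [mul_assoc] at hlen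
  rw [hl3] at e3
  rw [hl4] at e4
  obtain ⟨t, rfl⟩ := Nat.exists_eq_add_of_le hq1
  rw [add_assoc, hcongr s hl3.symm hl4.symm (t := t) (by omega),
    hcongr s hl3.symm hl4.symm (t := t + p) (by omega)]
  obtain ⟨r, hr⟩ := Nat.exists_eq_add_of_le (show i ≤ blockPos τ x s l + t by omega)
  rw [← add_assoc, hr, add_right_comm]
  exact (hi.apply_eq hip (by omega)).symm

end Primitive

section Discrepancy

/-- If all symbols of `y` are balanced, so is every function whose increments are determined
by `y`. -/
lemma abs_increment_sub_le {B : Type*} [Fintype B] [DecidableEq B] {y : ℕ → B} {D : ℝ}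
    (hD : ∀ b i j n, |(Nat.count (fun t => y (i + t) = b) n : ℝ) -
      Nat.count (fun t => y (j + t) = b) n| ≤ D)
    {G : ℕ → ℝ} {E : ℝ} (hG : ∀ i j, y i = y j → G (i + 1) - G i = G (j + 1) - G j)
    (h0 : ∀ i, G i ≤ G (i + 1)) (hE : ∀ i, G (i + 1) - G i ≤ E) (i j n : ℕ) :
    |(G (i + n) - G i) - (G (j + n) - G j)| ≤ (Fintype.card B * D) * E := by
  have hE0 : 0 ≤ E := by linarith [h0 0, hE 0]
  obtain ⟨h, hy, hh⟩ : ∃ h : B → ℝ, (∀ i, h (y i) = G (i + 1) - G i) ∧ ∀ b, |h b| ≤ E := by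
    refine ⟨fun b => if hb : ∃ i, y i = b then G (hb.choose + 1) - G hb.choose else 0,
      fun i => ?_, fun b => ?_⟩
    · have hb : ∃ k, y k = y i := ⟨i, rfl⟩
      simp only [dif_pos hb]
      exact hG _ _ hb.choose_spec
    · beta_reduce
      split_ifs with hb
      · rw [abs_of_nonneg (by linarith [h0 hb.choose])]
        exact hE _
      · simpa using hE0
  have hsum : ∀ i, G (i + n) - G i = ∑ b, h b * Nat.count (fun t => y (i + t) = b) n := by
    intro i
    have h1 := Finset.sum_range_sub (fun t => G (i + t)) n
    simp only [add_zero, ← add_assoc, ← hy] at h1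
    rw [← h1]
    simp only [Nat.count_eq_card_filter_range, Finset.card_filter, Nat.cast_sum, Finset.mul_sum]
    rw [Finset.sum_comm]
    refine Finset.sum_congr rfl fun t _ => ?_
    simp
  rw [hsum, hsum, ← Finset.sum_sub_distrib]
  refine (Finset.abs_sum_le_sum_abs _ _).trans ?_
  calc _ ≤ ∑ _b : B, D * E := by
        refine Finset.sum_le_sum fun b _ => ?_
        rw [← mul_sub, abs_mul, mul_comm]
        exact mul_le_mul (hD b i j n) (hh b) (abs_nonneg _) ((abs_nonneg _).trans (hD b i j n))
    _ = _ := by simp [mul_assoc]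

/-- A monotone function whose increments over blocks are bounded and balanced has balanced
increments over all windows. -/
lemma abs_increment_sub_le_of_blocks {pos : ℕ → ℕ} (h0 : pos 0 = 0)
    (hpos : ∀ j, pos j < pos (j + 1)) {F : ℕ → ℝ} (hF : Monotone F) {lo hi E K R : ℝ}
    (hlo0 : 0 < lo) (hR : hi ≤ R * lo) (hK : 0 ≤ K)
    (hlo : ∀ j, lo ≤ (pos (j + 1) : ℝ) - pos j) (hhi : ∀ j, (pos (j + 1) : ℝ) - pos j ≤ hi)
    (hE : ∀ j, F (pos (j + 1)) - F (pos j) ≤ E)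
    (hposK : ∀ i j n, |((pos (i + n) : ℝ) - pos i) - ((pos (j + n) : ℝ) - pos j)| ≤ K * hi)
    (hFK : ∀ i j n, |(F (pos (i + n)) - F (pos i)) - (F (pos (j + n)) - F (pos j))| ≤ K * E)
    (q r n : ℕ) :
    |(F (q + n) - F q) - (F (r + n) - F r)| ≤ (2 + K + (2 + K) * R) * E := by
  have hblock := exists_block h0 hpos
  have hmono : Monotone pos := (strictMono_nat_of_lt_succ hpos).monotone
  have hE0 : 0 ≤ E := by linarith [hE 0, hF (hpos 0).le]
  have hFE : ∀ i n, F (pos (i + n)) - F (pos i) ≤ n * E := by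
    intro i n
    induction n with
    | zero => simp
    | succ n ih => have := hE (i + n); push_cast; rw [← add_assoc]; linarith
  have hposlo : ∀ i n, n * lo ≤ (pos (i + n) : ℝ) - pos i := by
    intro i n
    induction n with
    | zero => simp
    | succ n ih => have := hlo (i + n); push_cast; rw [← add_assoc]; linarith
  have hnear : ∀ q, ∃ j, pos j ≤ q ∧ (q : ℝ) ≤ pos j + hi ∧ F (pos j) ≤ F q ∧
      F q ≤ F (pos j) + E ∧ q < pos (j + 1) := by
    intro q
    obtain ⟨j, hj, hj'⟩ := hblock q
    have h2 : (q : ℝ) ≤ pos (j + 1) := by exact_mod_cast hj'.le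
    exact ⟨j, hj, by linarith [hhi j], hF hj, by linarith [hE j, hF hj'.le], hj'⟩
  have hle : ∀ q q' j j', q ≤ q' → pos j ≤ q → q' < pos (j' + 1) → j ≤ j' := by
    intro q q' j j' h1 h2 h3
    by_contra! h
    have := hmono (show j' + 1 ≤ j from h)
    omega
  have hside : ∀ q r : ℕ, (F (q + n) - F q) - (F (r + n) - F r) ≤
      (2 + K + (2 + K) * R) * E := by
    intro q r
    obtain ⟨i, a1, a2, a3, a4, a5⟩ := hnear q
    obtain ⟨i', b1, b2, b3, b4, b5⟩ := hnear (q + n)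
    obtain ⟨j, c1, c2, c3, c4, c5⟩ := hnear r
    obtain ⟨j', d1, d2, d3, d4, d5⟩ := hnear (r + n)
    obtain ⟨M, rfl⟩ := Nat.exists_eq_add_of_le (hle _ _ _ _ (Nat.le_add_right q n) a1 b5)
    obtain ⟨M', rfl⟩ := Nat.exists_eq_add_of_le (hle _ _ _ _ (Nat.le_add_right r n) c1 d5)
    have hR0 : 0 ≤ (2 + K) * R * E := by
      have : 0 ≤ hi := by linarith [hlo 0, hhi 0]
      have : 0 ≤ R := by
        by_contra! h
        linarith [mul_neg_of_neg_of_pos h hlo0]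
      positivity
    rcases le_total M M' with h | h
    · have h1 := (abs_le.1 (hFK i j M)).2
      have h2 := hF (hmono (show j + M ≤ j + M' by omega))
      linarith [mul_nonneg hK hE0]
    · obtain ⟨s, rfl⟩ := Nat.exists_eq_add_of_le h
      have h1 := (abs_le.1 (hFK i j M')).2
      have h2 := (abs_le.1 (hposK i j M')).1
      have h3 := hposlo (i + M') s
      have h4 := hFE (i + M') s
      rw [← add_assoc] at b1 b2 b3 b4
      rify at a1 b1 c1 d1 a2 b2 c2 d2
      have h5 : s * lo ≤ ((2 + K) * R) * lo := by
        have : (2 + K) * hi ≤ (2 + K) * (R * lo) := by gcongr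
        linarith
      have h6 := mul_le_mul_of_nonneg_right (le_of_mul_le_mul_right h5 hlo0) hE0
      linarith
  rw [abs_le]
  constructor <;> linarith [hside q r, hside r q]

/-- A predicate whose occurrences are at distance more than `m / T` holds at most `Q * T` times in
a window of length `Q * m`. -/
lemma count_le_of_gap {P : ℕ → Prop} {m T Q L : ℕ} (hm : 0 < m) (hT : 0 < T) (hL : L ≤ Q * m)
    (hP : ∀ i p, 0 < p → P i → P (i + p) → m < T * p) : Nat.count P L ≤ Q * T := by
  rw [Nat.count_eq_card_filter_range, ← Finset.card_range (Q * T)]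
  refine Finset.card_le_card_of_injOn (fun i => T * i / m) ?_ ?_
  · intro i hi
    simp only [Finset.coe_filter, Finset.mem_range, Set.mem_ofPred_eq] at hi
    simp only [Finset.coe_range, Set.mem_Iio]
    rw [Nat.div_lt_iff_lt_mul hm]
    calc T * i < T * (Q * m) := Nat.mul_lt_mul_of_pos_left (by omega) hT
      _ = _ := by ring
  · have key : ∀ i j, i < j → P i → P j → T * i / m < T * j / m := by
      intro i j hij hi hj
      obtain ⟨p, rfl⟩ := Nat.exists_eq_add_of_le hij.le
      have h := hP i p (by omega) hi hj
      calc T * i / m < (T * i + m) / m := by rw [Nat.add_div_right _ hm]; omega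
        _ ≤ _ := Nat.div_le_div_right (by rw [mul_add]; omega)
    intro i hi j hj hij
    simp only [Finset.coe_filter, Finset.mem_range, Set.mem_ofPred_eq] at hi hj
    beta_reduce at hij
    rcases lt_trichotomy i j with h | h | h
    · have := key i j h hi.2 hj.2; omega
    · exact h
    · have := key j i h hj.2 hi.2; omega

end Discrepancy

section PairBalance

variable {A : Type*} [Fintype A]

/-- If all length-2 factors are balanced, all pairs of letters are balanced with one constant. -/
lemma exists_pair_balance {x : ℕ → A}
    (h : ∀ w : List A, IsFactor x w → w.length = 2 → ∃ C : ℝ, 0 < C ∧ BalancedIn C w x) :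
    ∃ D : ℝ, 0 ≤ D ∧ ∀ p : A × A, ∀ i j n,
      |(Nat.count (fun t => (x (i + t), x (i + t + 1)) = p) n : ℝ) -
        Nat.count (fun t => (x (j + t), x (j + t + 1)) = p) n| ≤ D := by
  have key : ∀ p : A × A, ∃ D : ℝ, 0 ≤ D ∧ ∀ i j n,
      |(Nat.count (fun t => (x (i + t), x (i + t + 1)) = p) n : ℝ) -
        Nat.count (fun t => (x (j + t), x (j + t + 1)) = p) n| ≤ D := by
    rintro ⟨b, c⟩
    by_cases hbc : IsFactor x [b, c]
    · obtain ⟨C, hC, hbal⟩ := h _ hbc rfl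
      rw [balancedIn_iff_count C hC.le] at hbal
      simp only [occursAt_pair] at hbal
      exact ⟨C, hC.le, hbal⟩
    · have hno : ∀ i, (x i, x (i + 1)) ≠ (b, c) := fun i hi =>
        hbc ⟨i, (occursAt_pair x b c i).2 hi⟩
      exact ⟨0, le_rfl, fun i j n => by simp [hno, Nat.count_false]⟩
  choose D hD0 hD using key
  exact ⟨∑ p, D p, Finset.sum_nonneg fun p _ => hD0 p, fun p i j n => (hD p i j n).trans
    (Finset.single_le_sum (fun p _ => hD0 p) (Finset.mem_univ p))⟩

/-- In a non-periodic fixed point of a primitive substitution, balance of length-2 factors lifts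
to all words with one constant. -/
lemma uniformlyFactorBalanced_of_gap {τ : A → List A} {a : A} (hprol : Prolongable τ a)
    (hprim : ∃ k, 1 ≤ k ∧ ∀ b b' : A, b ∈ substIter τ k b') {T : ℕ}
    (hT : ∀ (w : List A) (i p : ℕ), 0 < p → OccursAt (fixedPoint τ a) w i →
      OccursAt (fixedPoint τ a) w (i + p) → w.length < T * p)
    (h : ∀ w : List A, IsFactor (fixedPoint τ a) w → w.length = 2 →
      ∃ C : ℝ, 0 < C ∧ BalancedIn C w (fixedPoint τ a)) :
    UniformlyFactorBalanced (fixedPoint τ a) := by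
  obtain ⟨D, hD0, hD⟩ := exists_pair_balance h
  obtain ⟨Q, hQ⟩ := exists_scale hprol hprim
  have hcongr := @fixedPoint_block_pair_congr A τ a hprol
  set x := fixedPoint τ a
  set K : ℝ := Fintype.card (A × A) * D
  have hK : 0 ≤ K := by positivity
  set C : ℝ := (2 + K + (2 + K) * Q) * (Q * (T + 1) : ℕ)
  have hC : 0 ≤ C := by positivity
  refine ⟨C + 1, by positivity, fun w => ?_⟩
  rw [balancedIn_iff_count _ (by positivity)]
  rcases Nat.eq_zero_or_pos w.length with hw | hw
  · intro i j n
    simp only [List.length_eq_zero_iff.1 hw, OccursAt, List.length_nil, List.range_zero,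
      List.map_nil, sub_self, abs_zero]
    positivity
  obtain ⟨n, hn⟩ := hQ w.length hw
  have hcount : ∀ q r : ℕ, (Nat.count (fun t => OccursAt x w (q + t)) r : ℝ) =
      Nat.count (OccursAt x w) (q + r) - Nat.count (OccursAt x w) q := fun q r => by
    rw [Nat.count_add]; push_cast; ring
  have hlen : ∀ j, (blockPos τ x n (j + 1) : ℝ) - blockPos τ x n j =
      (substIter τ n (x j)).length := fun j => by
    rw [blockPos_succ]; push_cast; ring
  have hinc : ∀ j, (Nat.count (OccursAt x w) (blockPos τ x n (j + 1)) : ℝ) -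
      Nat.count (OccursAt x w) (blockPos τ x n j) =
      Nat.count (fun t => OccursAt x w (blockPos τ x n j + t)) (substIter τ n (x j)).length := by
    intro j
    rw [blockPos_succ, hcount]
  have hlo : ∀ j, (w.length : ℝ) ≤ (blockPos τ x n (j + 1) : ℝ) - blockPos τ x n j := fun j => by
    rw [hlen]; exact_mod_cast (hn _).1
  have hhi : ∀ j, (blockPos τ x n (j + 1) : ℝ) - blockPos τ x n j ≤ Q * w.length := fun j => by
    rw [hlen]; exact_mod_cast (hn _).2
  have hE : ∀ j, (Nat.count (OccursAt x w) (blockPos τ x n (j + 1)) : ℝ) -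
      Nat.count (OccursAt x w) (blockPos τ x n j) ≤ (Q * (T + 1) : ℕ) := by
    intro j
    rw [hinc]
    refine Nat.cast_le.2 (count_le_of_gap hw T.succ_pos (hn _).2 fun i p hp h1 h2 => ?_)
    exact (hT w _ p hp h1 (by rwa [add_assoc])).trans_le (Nat.mul_le_mul_right _ T.le_succ)
  have hmonoF : Monotone fun q => (Nat.count (OccursAt x w) q : ℝ) := fun _ _ hqr =>
    Nat.cast_le.2 (Nat.count_monotone _ hqr)
  have hpos := blockPos_lt_succ hprol.2.1 x n
  intro q r s
  rw [hcount, hcount]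
  have hw' : (0 : ℝ) < w.length := Nat.cast_pos.2 hw
  have hincr := fun G E =>
    abs_increment_sub_le (y := fun i => (x i, x (i + 1))) hD (G := G) (E := E)
  refine le_trans ?_ (show C ≤ C + 1 by linarith)
  refine abs_increment_sub_le_of_blocks (blockPos_zero τ x n) hpos
    (F := fun q => (Nat.count (OccursAt x w) q : ℝ))
    hmonoF hw' le_rfl hK hlo hhi hE ?_ ?_ q r s
  · refine hincr (fun j => (blockPos τ x n j : ℝ)) _ ?_ ?_ hhi
    · intro i j hij
      rw [hlen, hlen, show x i = x j from (Prod.ext_iff.1 hij).1]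
    · exact fun i => Nat.cast_le.2 (hpos i).le
  · refine hincr (fun j => (Nat.count (OccursAt x w) (blockPos τ x n j) : ℝ)) _ ?_ ?_ hE
    · intro i j hij
      obtain ⟨h1, h2⟩ := Prod.ext_iff.1 hij
      rw [hinc, hinc, ← show x i = x j from h1, Nat.count_eq_card_filter_range,
        Nat.count_eq_card_filter_range]
      congr 2
      refine Finset.filter_congr fun t ht => occursAt_congr fun u hu => ?_
      rw [add_assoc, add_assoc]
      have := (hn (x (i + 1))).1
      have := Finset.mem_range.1 ht
      exact hcongr n h1 h2 (by omega)
    · exact fun i => hmonoF (hpos i).le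

end PairBalance

/-- Theorem (Adamczewski, for primitive substitutive words): for the fixed point `x` of a
primitive substitution prolongable on `a`, every length-2 factor of `x` is balanced in `x`
if and only if `x` is uniformly factor-balanced. -/
theorem stmt1 {A : Type*} [Fintype A] (τ : A → List A) (a : A)
    (hprol : Prolongable τ a)
    (hprim : ∃ k, 1 ≤ k ∧ ∀ b b' : A, b ∈ substIter τ k b') :
    (∀ w : List A, IsFactor (fixedPoint τ a) w → w.length = 2 →
        ∃ C : ℝ, 0 < C ∧ BalancedIn C w (fixedPoint τ a)) ↔
      UniformlyFactorBalanced (fixedPoint τ a) := by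
  constructor
  · intro h
    rcases exists_gap_or_periodic hprol hprim with ⟨p, hp, hper⟩ | ⟨T, hT⟩
    · exact ⟨2 * p, by positivity, balancedIn_of_periodic hp hper⟩
    · exact uniformlyFactorBalanced_of_gap hprol hprim hT h
  · rintro ⟨C, hC, h⟩ w - -
    exact ⟨C, hC, h w⟩
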